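/- Let G ⊂ ℂ be a bounded Jordan domain whose boundary has planar Lebesgue measure zero. Let {G_n}_{n≥1} be a sequence of bounded Jordan domains such that each ∂G_n is a smooth Jordan curve, cl(G_{n+1}) ⊂ G_n for all n, and ⋂_{n≥1} G_n = cl(G); let φ_n be a conformal (biholomorphic) map of the unit disk 𝔻 onto G_n, extended to a homeomorphism of cl(𝔻) onto cl(G_n). If g ∈ B₂(G) and γ = Kg is its Cauchy transform, then for every n the boundary function θ ↦ γ(φ_n(e^{iθ})) is integrable and ρ(γ∘φ_n) ≤ ‖g‖_{B₂(G)}; in particular sup_{n≥1} ρ(γ∘φ_n(e^{iθ})) < ∞. -/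

import Mathlib

open Complex MeasureTheory Metric Set Filter Bornology

/-- A Jordan curve: the image of an injective continuous map of the unit circle into `ℂ`. -/
def IsJordanCurve (J : Set ℂ) : Prop :=
  ∃ f : ℂ → ℂ, ContinuousOn f (Metric.sphere 0 1) ∧
    Set.InjOn f (Metric.sphere 0 1) ∧ J = f '' Metric.sphere 0 1

/-- A Jordan domain: a bounded connected component of the complement of a Jordan curve. -/
def IsJordanDomain (G : Set ℂ) : Prop :=
  ∃ J : Set ℂ, IsJordanCurve J ∧ Bornology.IsBounded G ∧
    ∃ z ∈ Jᶜ, G = connectedComponentIn Jᶜ z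

/-- A smooth Jordan curve: admits a `C¹` periodic parametrization, injective on a period,
with nonvanishing derivative. -/
def IsSmoothJordanCurve (J : Set ℂ) : Prop :=
  ∃ p : ℝ → ℂ, ContDiff ℝ 1 p ∧ (∀ θ : ℝ, p (θ + 2 * Real.pi) = p θ) ∧
    Set.InjOn p (Set.Ico 0 (2 * Real.pi)) ∧ (∀ θ : ℝ, deriv p θ ≠ 0) ∧
    J = Set.range p

/-- Membership in the Bergman space `B₂(G)`: holomorphic with square-integrable modulus. -/
def MemB2 (G : Set ℂ) (g : ℂ → ℂ) : Prop :=
  DifferentiableOn ℂ g G ∧ IntegrableOn (fun z => ‖g z‖ ^ 2) G volume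

/-- The Cauchy transform `(Kg)(ζ) = (1/π) ∬_G conj (g z) / (z - ζ) dx dy`. -/
noncomputable def cauchyTransform (G : Set ℂ) (g : ℂ → ℂ) (ζ : ℂ) : ℂ :=
  (1 / Real.pi : ℂ) * ∫ z in G, (starRingEnd ℂ) (g z) / (z - ζ) ∂volume

/-- The `k`-th Fourier coefficient of the boundary function `θ ↦ f (e^{iθ})`. -/
noncomputable def fourierCoef (f : ℂ → ℂ) (k : ℤ) : ℂ :=
  (1 / (2 * Real.pi)) * ∫ θ in (0:ℝ)..(2 * Real.pi),
    f (Complex.exp (θ * Complex.I)) * Complex.exp (-(Complex.I * (k : ℂ) * (θ : ℂ)))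

theorem abs_det_restrictScalars_toSpanSingleton (c : ℂ) :
    |((ContinuousLinearMap.toSpanSingleton ℂ c).restrictScalars ℝ : ℂ →L[ℝ] ℂ).det| =
      ‖c‖ ^ 2 := by
  simp [ContinuousLinearMap.det, LinearMap.det_restrictScalars, Algebra.norm_complex_apply,
    Complex.normSq_eq_norm_sq]

theorem hasFDerivWithinAt_restrictScalars_of_differentiableOn {f : ℂ → ℂ} {U s : Set ℂ}
    (hU : IsOpen U) (hf : DifferentiableOn ℂ f U) (hs : s ⊆ U) :
    ∀ x ∈ s, HasFDerivWithinAt f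
      ((ContinuousLinearMap.toSpanSingleton ℂ (deriv f x)).restrictScalars ℝ : ℂ →L[ℝ] ℂ) s x :=
  fun _ hx => (((hf.differentiableAt (hU.mem_nhds (hs hx))).hasDerivAt.hasFDerivAt).restrictScalars
    ℝ).hasFDerivWithinAt

theorem setIntegral_image_eq_setIntegral_normSq_deriv {f : ℂ → ℂ} {s : Set ℂ} (hs : IsOpen s)
    (hf : DifferentiableOn ℂ f s) (hi : InjOn f s) {E : Type*} [NormedAddCommGroup E]
    [NormedSpace ℝ E] (h : ℂ → E) :
    ∫ z in f '' s, h z = ∫ w in s, ‖deriv f w‖ ^ 2 • h (f w) := by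
  rw [integral_image_eq_integral_abs_det_fderiv_smul volume hs.measurableSet
    (hasFDerivWithinAt_restrictScalars_of_differentiableOn hs hf subset_rfl) hi]
  simp only [abs_det_restrictScalars_toSpanSingleton]

theorem integrableOn_image_iff_normSq_deriv {f : ℂ → ℂ} {s : Set ℂ} (hs : IsOpen s)
    (hf : DifferentiableOn ℂ f s) (hi : InjOn f s) {E : Type*} [NormedAddCommGroup E]
    [NormedSpace ℝ E] (h : ℂ → E) :
    IntegrableOn h (f '' s) ↔ IntegrableOn (fun w => ‖deriv f w‖ ^ 2 • h (f w)) s := by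
  rw [integrableOn_image_iff_integrableOn_abs_det_fderiv_smul volume hs.measurableSet
    (hasFDerivWithinAt_restrictScalars_of_differentiableOn hs hf subset_rfl) hi]
  simp only [abs_det_restrictScalars_toSpanSingleton]

theorem integral_exp_pow_div_sub {f : ℂ → ℂ} (hfd : DifferentiableOn ℂ f (ball 0 1))
    (hfc : ContinuousOn f (closedBall 0 1)) (hfi : InjOn f (closedBall 0 1)) {w : ℂ}
    (hw : w ∈ ball (0 : ℂ) 1) (hd : deriv f w ≠ 0) (k : ℕ) :
    ∫ θ in (0 : ℝ)..(2 * Real.pi),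
        Complex.exp (θ * Complex.I) ^ (k + 1) / (f w - f (Complex.exp (θ * Complex.I))) =
      -(2 * Real.pi * (w ^ k / deriv f w)) := by
  have hne : ∀ u ∈ closedBall (0 : ℂ) 1, dslope f w u ≠ 0 := by
    intro u hu
    rcases eq_or_ne u w with rfl | huw
    · rwa [dslope_same]
    · rw [dslope_of_ne _ huw, slope_def_field]
      exact div_ne_zero (sub_ne_zero.2 fun h => huw (hfi hu (ball_subset_closedBall hw) h))
        (sub_ne_zero.2 huw)
  have hF : DiffContOnCl ℂ (fun u => u ^ k / dslope f w u) (ball 0 1) := by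
    refine ⟨?_, ?_⟩
    · exact (differentiable_pow k).differentiableOn.div
        ((differentiableOn_dslope (isOpen_ball.mem_nhds hw)).2 hfd)
        fun u hu => hne u (ball_subset_closedBall hu)
    · rw [closure_ball _ one_ne_zero]
      exact (continuous_pow k).continuousOn.div
        ((continuousOn_dslope (mem_of_superset (isOpen_ball.mem_nhds hw)
          ball_subset_closedBall)).2
          ⟨hfc, hfd.differentiableAt (isOpen_ball.mem_nhds hw)⟩) hne
  have h := hF.circleIntegral_sub_inv_smul hw
  rw [circleIntegral, dslope_same] at h
  have hcongr : ∀ θ : ℝ, Complex.exp (θ * Complex.I) ^ (k + 1) /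
      (f w - f (Complex.exp (θ * Complex.I))) =
      Complex.I * (deriv (circleMap 0 1) θ • (circleMap 0 1 θ - w)⁻¹ •
        (circleMap 0 1 θ ^ k / dslope f w (circleMap 0 1 θ))) := by
    intro θ
    have hu : circleMap 0 1 θ ≠ w := by
      rintro rfl
      simp at hw
    rw [deriv_circleMap, dslope_of_ne _ hu, slope_def_field]
    have hfu : f (circleMap 0 1 θ) - f w ≠ 0 := sub_ne_zero.2 fun h => hu
      (hfi (sphere_subset_closedBall (circleMap_mem_sphere 0 zero_le_one θ))
        (ball_subset_closedBall hw) h)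
    have he : Complex.exp (θ * Complex.I) = circleMap 0 1 θ := by simp [circleMap]
    rw [he]
    have hfu' : f w - f (circleMap 0 1 θ) ≠ 0 := by rwa [← neg_sub, neg_ne_zero]
    have hu' := sub_ne_zero.2 hu
    simp only [smul_eq_mul]
    field_simp
    linear_combination
      (circleMap 0 1 θ ^ (k + 1) * (f (circleMap 0 1 θ) - f w)) * I_sq
  simp_rw [hcongr]
  rw [intervalIntegral.integral_const_mul, h, smul_eq_mul]
  linear_combination (2 * Real.pi * (w ^ k / deriv f w)) * I_sq

theorem setIntegral_ball_conj_pow_mul_pow (m k : ℕ) :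
    ∫ w in ball (0 : ℂ) 1, (starRingEnd ℂ) (w ^ m) * w ^ k =
      if m = k then (Real.pi / (k + 1) : ℂ) else 0 := by
  rw [← integral_indicator measurableSet_ball, ← Complex.integral_comp_polarCoord_symm]
  have : ∀ p ∈ polarCoord.target, p.1 • (ball (0 : ℂ) 1).indicator
      (fun w => (starRingEnd ℂ) (w ^ m) * w ^ k) (Complex.polarCoord.symm p) =
      (Iio (1 : ℝ)).indicator (fun r => (r : ℂ) ^ (m + k + 1)) p.1 *
        Complex.exp (((k : ℂ) - m) * I * p.2) := by
    rintro ⟨r, θ⟩ ⟨hr, -⟩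
    have hr : 0 < r := hr
    have hn : ‖Complex.polarCoord.symm (r, θ)‖ = r := by
      rw [Complex.norm_polarCoord_symm, abs_of_pos hr]
    have he : Complex.polarCoord.symm (r, θ) = r * Complex.exp (θ * I) := by
      rw [Complex.polarCoord_symm_apply, Complex.exp_mul_I]
      push_cast
      rfl
    by_cases h1 : r < 1
    · rw [indicator_of_mem (by rwa [mem_ball_zero_iff, hn]), indicator_of_mem (by simpa using h1), he]
      have hexp : Complex.exp (((k : ℂ) - m) * I * θ) =
          (starRingEnd ℂ) (Complex.exp (θ * I)) ^ m * Complex.exp (θ * I) ^ k := by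
        rw [← Complex.exp_conj, ← Complex.exp_nat_mul, ← Complex.exp_nat_mul, ← Complex.exp_add]
        congr 1
        simp
        ring
      rw [hexp]
      simp only [map_pow, map_mul, Complex.conj_ofReal, Complex.real_smul]
      ring
    · rw [indicator_of_notMem (by rwa [mem_ball_zero_iff, hn]), indicator_of_notMem (by simpa using h1)]
      simp
  rw [setIntegral_congr_fun polarCoord.open_target.measurableSet this]
  rw [polarCoord_target, Measure.volume_eq_prod]
  rw [setIntegral_prod_mul (fun r => (Iio (1 : ℝ)).indicator (fun r => (r : ℂ) ^ (m + k + 1)) r)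
    (fun θ : ℝ => Complex.exp (((k : ℂ) - m) * I * θ))]
  rw [setIntegral_indicator measurableSet_Iio, Ioi_inter_Iio,
    ← integral_Ioc_eq_integral_Ioo, ← integral_Ioc_eq_integral_Ioo,
    ← intervalIntegral.integral_of_le zero_le_one,
    ← intervalIntegral.integral_of_le (by linarith [Real.pi_pos])]
  rcases eq_or_ne m k with rfl | hmk
  · simp only [← Complex.ofReal_pow, intervalIntegral.integral_ofReal, integral_pow]
    have : (m : ℂ) + 1 ≠ 0 := Nat.cast_add_one_ne_zero m
    have h2 : (m : ℂ) + m + 1 + 1 ≠ 0 := by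
      convert mul_ne_zero two_ne_zero this using 1
      ring
    have h3 : ((m : ℂ) + m + 1 + 1)⁻¹ * (2 * ((m : ℂ) + 1)) = 1 := by
      rw [inv_mul_eq_one₀ h2]
      ring
    simp
    field_simp
    linear_combination h3
  · have hc : ((k : ℂ) - m) * I ≠ 0 :=
      mul_ne_zero (sub_ne_zero.2 (by exact_mod_cast hmk.symm)) I_ne_zero
    have hper : Complex.exp (((k : ℂ) - m) * I * Real.pi) =
        Complex.exp (((k : ℂ) - m) * I * (-Real.pi : ℝ)) := by
      rw [Complex.exp_eq_exp_iff_exists_int]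
      exact ⟨k - m, by push_cast; ring⟩
    rw [integral_exp_mul_complex hc, hper, sub_self, zero_div, mul_zero, if_neg hmk]

theorem memLp_pow_ball (c : ℂ) (k : ℕ) :
    MemLp (fun w : ℂ => c * w ^ k) 2 (volume.restrict (ball 0 1)) := by
  have : IsFiniteMeasure (volume.restrict (ball (0 : ℂ) 1)) :=
    ⟨by simp⟩
  refine MemLp.of_bound (by fun_prop) ‖c‖ ?_
  filter_upwards [ae_restrict_mem measurableSet_ball] with w hw
  rw [norm_mul, norm_pow]
  exact mul_le_of_le_one_right (norm_nonneg _)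
    (pow_le_one₀ (norm_nonneg _) (mem_ball_zero_iff.1 hw).le)

theorem inner_toLp_eq_integral {α : Type*} [MeasurableSpace α] {μ : Measure α} {f h : α → ℂ}
    (hf : MemLp f 2 μ) (hh : MemLp h 2 μ) :
    inner ℂ (hf.toLp f) (hh.toLp h) = ∫ a, (starRingEnd ℂ) (f a) * h a ∂μ := by
  rw [L2.inner_def]
  refine integral_congr_ae ?_
  filter_upwards [hf.coeFn_toLp, hh.coeFn_toLp] with a h1 h2
  rw [h1, h2, RCLike.inner_apply, mul_comm]

theorem orthonormal_pow_ball :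
    Orthonormal ℂ fun k : ℕ =>
      (memLp_pow_ball (Real.sqrt ((k + 1) / Real.pi) : ℂ) k).toLp _ := by
  rw [orthonormal_iff_ite]
  intro m k
  rw [inner_toLp_eq_integral]
  have : ∀ w : ℂ, (starRingEnd ℂ) ((Real.sqrt ((m + 1) / Real.pi) : ℂ) * w ^ m) *
      ((Real.sqrt ((k + 1) / Real.pi) : ℂ) * w ^ k) =
      ((Real.sqrt ((m + 1) / Real.pi) : ℂ) * (Real.sqrt ((k + 1) / Real.pi) : ℂ)) *
        ((starRingEnd ℂ) (w ^ m) * w ^ k) := by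
    intro w
    rw [map_mul, Complex.conj_ofReal]
    ring
  simp_rw [this]
  rw [integral_const_mul, setIntegral_ball_conj_pow_mul_pow]
  rcases eq_or_ne m k with rfl | hmk
  · have h1 : (m : ℂ) + 1 ≠ 0 := Nat.cast_add_one_ne_zero m
    have h2 : (Real.pi : ℂ) ≠ 0 := by exact_mod_cast Real.pi_ne_zero
    rw [if_pos rfl, if_pos rfl, ← Complex.ofReal_mul, Real.mul_self_sqrt (by positivity)]
    push_cast
    field_simp
  · simp [hmk]

/-- Bessel's inequality for the monomials in `L²` of the unit disk. -/
theorem bessel_pow_ball {F : ℂ → ℂ} (hF : MemLp F 2 (volume.restrict (ball 0 1))) :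
    (Summable fun k : ℕ =>
      ((k : ℝ) + 1) * ‖∫ w in ball (0 : ℂ) 1, (starRingEnd ℂ) (F w) * w ^ k‖ ^ 2) ∧
    ∑' k : ℕ, ((k : ℝ) + 1) * ‖∫ w in ball (0 : ℂ) 1, (starRingEnd ℂ) (F w) * w ^ k‖ ^ 2 ≤
      Real.pi * ∫ w in ball (0 : ℂ) 1, ‖F w‖ ^ 2 := by
  have hterm : ∀ k : ℕ,
      ((k : ℝ) + 1) * ‖∫ w in ball (0 : ℂ) 1, (starRingEnd ℂ) (F w) * w ^ k‖ ^ 2 =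
      Real.pi * ‖inner ℂ ((memLp_pow_ball (Real.sqrt ((k + 1) / Real.pi) : ℂ) k).toLp _)
        (hF.toLp F)‖ ^ 2 := by
    intro k
    rw [norm_inner_symm, inner_toLp_eq_integral]
    simp_rw [mul_left_comm _ (Real.sqrt ((k + 1) / Real.pi) : ℂ)]
    rw [integral_const_mul, norm_mul, Complex.norm_real, Real.norm_eq_abs, mul_pow, sq_abs,
      Real.sq_sqrt (by positivity)]
    field_simp
  have hnorm : ‖hF.toLp F‖ ^ 2 = ∫ w in ball (0 : ℂ) 1, ‖F w‖ ^ 2 := by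
    have h : ((‖hF.toLp F‖ ^ 2 : ℝ) : ℂ) = ((∫ w in ball (0 : ℂ) 1, ‖F w‖ ^ 2 : ℝ) : ℂ) := by
      rw [← integral_complex_ofReal, Complex.ofReal_pow, ← Complex.coe_algebraMap,
        ← inner_self_eq_norm_sq_to_K (𝕜 := ℂ), inner_toLp_eq_integral]
      simp [Complex.conj_mul']
    exact_mod_cast h
  simp_rw [hterm, ← hnorm]
  rw [tsum_mul_left]
  exact ⟨(orthonormal_pow_ball.inner_products_summable _).mul_left _,
    mul_le_mul_of_nonneg_left (orthonormal_pow_ball.tsum_inner_products_le _) Real.pi_pos.le⟩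

theorem integrable_conj_mul_pow_div {G : Set ℂ} {g f : ℂ → ℂ} (hG : MeasurableSet G)
    (hg : IntegrableOn g G) (hfc : ContinuousOn f (closedBall 0 1))
    (hd : Disjoint (closure G) (f '' sphere 0 1)) (m : ℕ) :
    Integrable (fun p : ℝ × ℂ => (starRingEnd ℂ) (g p.2) *
        (Complex.exp (p.1 * I) ^ m / (p.2 - f (Complex.exp (p.1 * I)))))
      ((volume.restrict (Ioc 0 (2 * Real.pi))).prod (volume.restrict G)) := by
  have hmem : ∀ θ : ℝ, Complex.exp (θ * I) ∈ sphere (0 : ℂ) 1 := by simp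
  have hcont : Continuous fun θ : ℝ => f (Complex.exp (θ * I)) :=
    hfc.comp_continuous (by fun_prop) fun θ => sphere_subset_closedBall (hmem θ)
  obtain ⟨δ, hδ, hdist⟩ := Metric.exists_pos_forall_lt_edist
    ((isCompact_sphere (0 : ℂ) 1).image_of_continuousOn (hfc.mono sphere_subset_closedBall))
    isClosed_closure hd.symm
  have hint : Integrable (fun p : ℝ × ℂ => (starRingEnd ℂ) (g p.2))
      ((volume.restrict (Ioc 0 (2 * Real.pi))).prod (volume.restrict G)) :=
    Integrable.comp_snd (f := fun z => (starRingEnd ℂ) (g z))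
      (Complex.conjLIE.integrable_comp_iff.2 hg) _
  refine hint.mul_bdd (c := (δ : ℝ)⁻¹) ?_ ?_
  · refine Measurable.aestronglyMeasurable ?_
    exact (by fun_prop : Measurable fun p : ℝ × ℂ => Complex.exp (p.1 * I) ^ m).div
      (measurable_snd.sub (hcont.measurable.comp measurable_fst))
  · rw [Measure.prod_restrict]
    filter_upwards [ae_restrict_mem (measurableSet_Ioc.prod hG)] with p hp
    have h := hdist _ (mem_image_of_mem f (hmem p.1)) _ (subset_closure hp.2)
    rw [edist_comm, edist_nndist, ENNReal.coe_lt_coe, ← NNReal.coe_lt_coe, coe_nndist,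
      dist_eq_norm] at h
    rw [norm_div, norm_pow, mem_sphere_zero_iff_norm.1 (hmem p.1), one_pow, one_div]
    exact inv_anti₀ hδ h.le

theorem fourierCoef_cauchyTransform_comp {G : Set ℂ} {g f : ℂ → ℂ} (hG : IsOpen G)
    (hg : IntegrableOn g G) (hfd : DifferentiableOn ℂ f (ball 0 1))
    (hfc : ContinuousOn f (closedBall 0 1)) (hfi : InjOn f (closedBall 0 1))
    (hsub : closure G ⊆ f '' ball 0 1) (hd : Disjoint (closure G) (f '' sphere 0 1)) (k : ℕ) :
    fourierCoef (cauchyTransform G g ∘ f) (-((k : ℤ) + 1)) =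
      -(1 / Real.pi * ∫ w in ball 0 1 ∩ f ⁻¹' G,
        (starRingEnd ℂ) (g (f w) * deriv f w) * w ^ k) := by
  have hpi : (Real.pi : ℂ) ≠ 0 := by exact_mod_cast Real.pi_ne_zero
  have hE : IsOpen (ball 0 1 ∩ f ⁻¹' G) :=
    (hfc.mono ball_subset_closedBall).isOpen_inter_preimage isOpen_ball hG
  have himage : f '' (ball 0 1 ∩ f ⁻¹' G) = G := by
    rw [image_inter_preimage]
    exact inter_eq_right.2 (subset_closure.trans hsub)
  have hswap : ∫ θ in (0 : ℝ)..(2 * Real.pi), ∫ z in G, (starRingEnd ℂ) (g z) *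
      (Complex.exp (θ * I) ^ (k + 1) / (z - f (Complex.exp (θ * I)))) =
      ∫ z in G, (starRingEnd ℂ) (g z) * ∫ θ in (0 : ℝ)..(2 * Real.pi),
        Complex.exp (θ * I) ^ (k + 1) / (z - f (Complex.exp (θ * I))) := by
    rw [intervalIntegral.integral_of_le Real.two_pi_pos.le,
      integral_integral_swap (integrable_conj_mul_pow_div hG.measurableSet hg hfc hd (k + 1))]
    simp_rw [integral_const_mul, intervalIntegral.integral_of_le Real.two_pi_pos.le]
  have hcoef : ∀ θ : ℝ, (cauchyTransform G g ∘ f) (Complex.exp (θ * I)) *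
      Complex.exp (-(I * ((-((k : ℤ) + 1) : ℤ) : ℂ) * θ)) =
      1 / Real.pi * ∫ z in G, (starRingEnd ℂ) (g z) *
        (Complex.exp (θ * I) ^ (k + 1) / (z - f (Complex.exp (θ * I)))) := by
    intro θ
    have he : Complex.exp (-(I * ((-((k : ℤ) + 1) : ℤ) : ℂ) * θ)) =
        Complex.exp (θ * I) ^ (k + 1) := by
      rw [← Complex.exp_nat_mul]
      congr 1
      push_cast
      ring
    rw [he, Function.comp_apply, cauchyTransform, mul_assoc, ← integral_mul_const]
    congr 2 with z
    ring
  have hcov : ∫ z in G, (starRingEnd ℂ) (g z) * ∫ θ in (0 : ℝ)..(2 * Real.pi),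
        Complex.exp (θ * I) ^ (k + 1) / (z - f (Complex.exp (θ * I))) =
      -(2 * Real.pi * ∫ w in ball 0 1 ∩ f ⁻¹' G,
        (starRingEnd ℂ) (g (f w) * deriv f w) * w ^ k) := by
    conv_lhs => rw [← himage]
    rw [setIntegral_image_eq_setIntegral_normSq_deriv hE (hfd.mono inter_subset_left)
      (hfi.mono (inter_subset_left.trans ball_subset_closedBall)), ← integral_const_mul,
      ← integral_neg]
    refine setIntegral_congr_fun hE.measurableSet fun w hw => ?_
    by_cases h0 : deriv f w = 0
    · simp [h0]
    · simp only [integral_exp_pow_div_sub hfd hfc hfi hw.1 h0 k, map_mul, Complex.real_smul,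
        Complex.ofReal_pow, ← Complex.conj_mul']
      field_simp
  rw [fourierCoef]
  simp_rw [hcoef]
  rw [intervalIntegral.integral_const_mul, hswap, hcov]
  field_simp

/-- For a Jordan domain `G` with null boundary, an exhausting sequence `{Gₙ}` of smoothly
bounded Jordan domains with conformal parametrizations `φₙ : 𝔻 → Gₙ` (extended to
homeomorphisms of the closures), and `g ∈ B₂(G)` with Cauchy transform `γ = Kg`,
each boundary function `θ ↦ γ(φₙ(e^{iθ}))` is integrable and
`ρ(γ∘φₙ) ≤ ‖g‖_{B₂(G)}` (i.e. `π Σ_{k≥1} k |(γ∘φₙ)_{-k}|² ≤ ∬_G |g|²`);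
in particular `sup_n ρ(γ∘φₙ) < ∞`. -/
theorem rho_of_cauchyTransform_le (G : Set ℂ) (hG : IsJordanDomain G)
    (hbd : volume (frontier G) = 0)
    (Gs : ℕ → Set ℂ)
    (hGsJ : ∀ n, IsJordanDomain (Gs n))
    (hGsSm : ∀ n, IsSmoothJordanCurve (frontier (Gs n)))
    (hnest : ∀ n, closure (Gs (n + 1)) ⊆ Gs n)
    (hinter : (⋂ n, Gs n) = closure G)
    (φ : ℕ → ℂ → ℂ)
    (hφd : ∀ n, DifferentiableOn ℂ (φ n) (Metric.ball 0 1))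
    (hφc : ∀ n, ContinuousOn (φ n) (Metric.closedBall 0 1))
    (hφi : ∀ n, Set.InjOn (φ n) (Metric.closedBall 0 1))
    (hφim : ∀ n, φ n '' Metric.ball 0 1 = Gs n)
    (hφcl : ∀ n, φ n '' Metric.closedBall 0 1 = closure (Gs n))
    (g : ℂ → ℂ) (hg : MemB2 G g) :
    ∀ n : ℕ,
      IntervalIntegrable
        (fun θ : ℝ => cauchyTransform G g (φ n (Complex.exp (θ * Complex.I))))
        volume 0 (2 * Real.pi) ∧
      Summable (fun k : ℕ =>
        ((k : ℝ) + 1) * ‖fourierCoef (cauchyTransform G g ∘ φ n) (-((k : ℤ) + 1))‖ ^ 2) ∧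
      Real.pi * ∑' k : ℕ,
          ((k : ℝ) + 1) * ‖fourierCoef (cauchyTransform G g ∘ φ n) (-((k : ℤ) + 1))‖ ^ 2 ≤
        ∫ z in G, ‖g z‖ ^ 2 ∂volume := by
  intro n
  obtain ⟨J, ⟨p, hpc, -, rfl⟩, hGb, z₀, -, rfl⟩ := hG
  have hJ : IsClosed (p '' sphere 0 1) :=
    ((isCompact_sphere (0 : ℂ) 1).image_of_continuousOn hpc).isClosed
  have hGo := hJ.isOpen_compl.connectedComponentIn (x := z₀)
  set G := connectedComponentIn (p '' sphere 0 1)ᶜ z₀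
  have hsub : closure G ⊆ φ n '' ball 0 1 := by
    rw [hφim, ← hinter]
    exact iInter_subset _ n
  have hd : Disjoint (closure G) (φ n '' sphere 0 1) := by
    rw [Set.disjoint_left]
    rintro z hz ⟨u, hu, rfl⟩
    obtain ⟨w, hw, hwu⟩ := hsub hz
    rw [hφi n (ball_subset_closedBall hw) (sphere_subset_closedBall hu) hwu] at hw
    exact (mem_ball.1 hw).ne (mem_sphere.1 hu)
  have : IsFiniteMeasure (volume.restrict G) := ⟨by simpa using hGb.measure_lt_top⟩
  have hgm : AEStronglyMeasurable g (volume.restrict G) :=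
    hg.1.continuousOn.aestronglyMeasurable hGo.measurableSet
  have hg1 : IntegrableOn g G :=
    ((memLp_two_iff_integrable_sq_norm hgm).2 hg.2).integrable one_le_two
  have hE : IsOpen (ball 0 1 ∩ φ n ⁻¹' G) :=
    ((hφc n).mono ball_subset_closedBall).isOpen_inter_preimage isOpen_ball hGo
  have himage : φ n '' (ball 0 1 ∩ φ n ⁻¹' G) = G := by
    rw [image_inter_preimage]
    exact inter_eq_right.2 (subset_closure.trans hsub)
  have hEd := (hφd n).mono (inter_subset_left (t := φ n ⁻¹' G))
  have hEi := (hφi n).mono ((inter_subset_left (t := φ n ⁻¹' G)).trans ball_subset_closedBall)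
  set E := ball 0 1 ∩ φ n ⁻¹' G
  set F : ℂ → ℂ := E.indicator fun w => g (φ n w) * deriv (φ n) w with hF
  have hEball : E ∩ ball 0 1 = E := inter_eq_left.2 inter_subset_left
  have hFsq : (fun w => ‖F w‖ ^ 2) =
      E.indicator fun w => ‖deriv (φ n) w‖ ^ 2 • ‖g (φ n w)‖ ^ 2 := by
    ext w
    by_cases hw : w ∈ E <;> simp [hF, hw, mul_pow, mul_comm]
  have hFm : AEStronglyMeasurable F (volume.restrict (ball 0 1)) := by
    refine AEStronglyMeasurable.restrict ?_
    rw [hF, aestronglyMeasurable_indicator_iff hE.measurableSet]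
    exact ((hg.1.continuousOn.comp hEd.continuousOn fun w hw => hw.2).mul
      (hEd.deriv hE).continuousOn).aestronglyMeasurable hE.measurableSet
  have hFL : MemLp F 2 (volume.restrict (ball 0 1)) := by
    rw [memLp_two_iff_integrable_sq_norm hFm, hFsq]
    refine Integrable.restrict ?_
    rw [integrable_indicator_iff hE.measurableSet]
    refine (integrableOn_image_iff_normSq_deriv hE hEd hEi (fun z => ‖g z‖ ^ 2)).1 ?_
    rw [himage]
    exact hg.2
  have hFnorm : ∫ w in ball (0 : ℂ) 1, ‖F w‖ ^ 2 = ∫ z in G, ‖g z‖ ^ 2 := by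
    rw [hFsq, setIntegral_indicator hE.measurableSet, inter_comm, hEball]
    conv_rhs => rw [← himage]
    rw [setIntegral_image_eq_setIntegral_normSq_deriv hE hEd hEi]
  have hFpow : ∀ k : ℕ, ∫ w in ball (0 : ℂ) 1, (starRingEnd ℂ) (F w) * w ^ k =
      ∫ w in E, (starRingEnd ℂ) (g (φ n w) * deriv (φ n) w) * w ^ k := by
    intro k
    rw [show E = ball 0 1 ∩ E by rw [inter_comm, hEball], ← setIntegral_indicator hE.measurableSet]
    congr 1 with w
    by_cases hw : w ∈ E <;> simp [hF, hw]
  have hterm : ∀ k : ℕ, ((k : ℝ) + 1) *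
      ‖fourierCoef (cauchyTransform G g ∘ φ n) (-((k : ℤ) + 1))‖ ^ 2 =
      (Real.pi ^ 2)⁻¹ * (((k : ℝ) + 1) *
        ‖∫ w in ball (0 : ℂ) 1, (starRingEnd ℂ) (F w) * w ^ k‖ ^ 2) := by
    intro k
    rw [fourierCoef_cauchyTransform_comp hGo hg1 (hφd n) (hφc n) (hφi n) hsub hd, hFpow]
    rw [norm_neg, norm_mul, norm_div, norm_one, Complex.norm_real, Real.norm_eq_abs, mul_pow,
      div_pow, sq_abs]
    ring
  obtain ⟨hsum, hle⟩ := bessel_pow_ball hFL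
  rw [hFnorm] at hle
  simp_rw [hterm]
  refine ⟨?_, hsum.mul_left _, ?_⟩
  · rw [intervalIntegrable_iff_integrableOn_Ioc_of_le Real.two_pi_pos.le]
    refine ((integrable_conj_mul_pow_div hGo.measurableSet hg1 (hφc n) hd
      0).integral_prod_left.const_mul (1 / Real.pi : ℂ)).congr ?_
    simp [cauchyTransform, div_eq_mul_inv]
  · rw [tsum_mul_left]
    calc Real.pi * ((Real.pi ^ 2)⁻¹ * _) = Real.pi⁻¹ * _ := by
          rw [← mul_assoc]
          congr 1
          field_simp
      _ ≤ Real.pi⁻¹ * _ := mul_le_mul_of_nonneg_left hle (by positivity)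
      _ = _ := inv_mul_cancel_left₀ Real.pi_ne_zero _
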